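/- arXiv:0801.3438 — 2 statements merged into one kernel-verified Lean document; each statement's English description precedes it below -/
import Mathlib

section
/- The dual Cauchy identity: ∏_{i=1}^N ∏_{j=1}^M (1 + x_i y_j) = Σ_λ s_λ(x₁,…,x_N) s_{λ'}(y₁,…,y_M), summing over partitions λ fitting in an N×M rectangle, where λ' is the conjugate partition. -/
open MvPolynomial

/-- `h_n` extended to integer index: `0` for negative `n`. -/
noncomputable def hz (σ : Type*) [Fintype σ] [DecidableEq σ] (n : ℤ) :
    MvPolynomial σ ℚ :=
  if 0 ≤ n then hsymm σ ℚ n.toNat else 0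

/-- The Schur polynomial `s_λ`, via the Jacobi–Trudi determinant
`s_λ = det(h_{λ_i − i + j})_{i,j}`. -/
noncomputable def schur (σ : Type*) [Fintype σ] [DecidableEq σ] {K : ℕ}
    (lam : Fin K → ℕ) : MvPolynomial σ ℚ :=
  (Matrix.of fun i j : Fin K => hz σ ((lam i : ℤ) - (i : ℤ) + (j : ℤ))).det

/-- Partitions with at most `K` parts, each part at most `d`, encoded as
weakly decreasing tuples. -/
noncomputable def partitionsLE (K d : ℕ) : Finset (Fin K → ℕ) :=
  (Fintype.piFinset fun _ => Finset.range (d + 1)).filter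
    fun l => ∀ i j : Fin K, i ≤ j → l j ≤ l i

/-- The conjugate of a partition with at most `N` parts, all `≤ M`, as a
partition with at most `M` parts. -/
def conjF {N : ℕ} (l : Fin N → ℕ) (M : ℕ) : Fin M → ℕ := fun j =>
  (Finset.univ.filter fun i : Fin N => (j : ℕ) + 1 ≤ l i).card

open Finset in
/-- The Cauchy–Binet formula. -/
theorem Matrix.det_mul_eq_sum_strictMono {R ι : Type*} [CommRing R] [Fintype ι] [LinearOrder ι]
    {n : ℕ} (A : Matrix (Fin n) ι R) (B : Matrix ι (Fin n) R) :
    (A * B).det = ∑ p : Fin n → ι with StrictMono p,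
      (A.submatrix id p).det * (B.submatrix p id).det := by
  have hexpand : (A * B).det = ∑ p : Fin n → ι, (∏ i, A i (p i)) * (B.submatrix p id).det := by
    have h := (Matrix.detRowAlternating (n := Fin n) (R := R)).toMultilinearMap.map_sum
      (fun i k => A i k • B k)
    have hrow : (fun i => ∑ k, A i k • B k) = A * B := by
      ext i j
      simp [Matrix.mul_apply]
    rw [hrow] at h
    refine h.trans (sum_congr rfl fun p _ => ?_)
    rw [MultilinearMap.map_smul_univ]
    rfl
  have hinj : ∑ p : Fin n → ι, (∏ i, A i (p i)) * (B.submatrix p id).det =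
      ∑ p : Fin n → ι with p.Injective, (∏ i, A i (p i)) * (B.submatrix p id).det := by
    refine (sum_subset (filter_subset _ _) fun p _ hp => ?_).symm
    obtain ⟨i, j, hij, hne⟩ : ∃ i j, p i = p j ∧ i ≠ j := by
      by_contra! h
      exact hp (mem_filter.mpr ⟨mem_univ _, h⟩)
    rw [Matrix.det_zero_of_row_eq hne (by ext; simp [hij]), mul_zero]
  have hfactor : ∑ q ∈ ({p : Fin n → ι | StrictMono p} : Finset (Fin n → ι)) ×ˢ
        (univ : Finset (Equiv.Perm (Fin n))),
        (∏ i, A i (q.1 (q.2 i))) * (B.submatrix (q.1 ∘ q.2) id).det =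
      ∑ p : Fin n → ι with p.Injective, (∏ i, A i (p i)) * (B.submatrix p id).det := by
    refine sum_bij (fun q _ => q.1 ∘ q.2) ?_ ?_ ?_ fun _ _ => rfl
    · rintro ⟨p, σ⟩ h
      simp only [mem_product, mem_filter, mem_univ, true_and, and_true] at h ⊢
      exact h.injective.comp σ.injective
    · rintro ⟨p, σ⟩ h ⟨p', σ'⟩ h' heq
      simp only [mem_product, mem_filter, mem_univ, true_and, and_true] at h h' heq
      have hp : p = p' := by
        have := Tuple.unique_monotone (f := p ∘ σ) (σ := σ⁻¹) (τ := σ'⁻¹)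
          (by convert h.monotone; ext; simp) (by rw [heq]; convert h'.monotone; ext; simp)
        conv_rhs at this => rw [heq]
        convert this using 1 <;> ext <;> simp
      subst hp
      refine Prod.ext rfl (Equiv.ext fun i => h.injective (congrFun heq i))
    · intro p hp
      simp only [mem_filter, mem_univ, true_and] at hp
      refine ⟨⟨p ∘ Tuple.sort p, (Tuple.sort p)⁻¹⟩, ?_, ?_⟩
      · simp only [mem_product, mem_filter, mem_univ, true_and, and_true]
        exact (Tuple.monotone_sort p).strictMono_of_injective
          (hp.comp (Tuple.sort p).injective)
      · ext; simp
  rw [hexpand, hinj, ← hfactor, sum_product]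
  refine sum_congr rfl fun p _ => ?_
  rw [Matrix.det_apply', ← Equiv.sum_comp (Equiv.inv (Equiv.Perm (Fin n))) fun σ => _ * _, sum_mul]
  refine sum_congr rfl fun σ _ => ?_
  have hdet : (B.submatrix (p ∘ ⇑σ⁻¹) id).det =
      (Equiv.Perm.sign σ : ℤ) * (B.submatrix p id).det := by
    rw [← Equiv.Perm.sign_inv, ← Matrix.det_permute]
    rfl
  have hprod : ∏ i, A.submatrix id p (σ i) i = ∏ i, A i (p (σ⁻¹ i)) := by
    rw [← Equiv.prod_comp σ fun i => A i (p (σ⁻¹ i))]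
    simp
  rw [Equiv.inv_apply, hprod]
  dsimp only
  rw [hdet]
  ring

/-- Jacobi's identity for complementary minors of a matrix and its inverse. -/
theorem Matrix.det_toBlocks₁₁_of_mul_eq_one {R m n : Type*} [CommRing R] [Fintype m] [Fintype n]
    [DecidableEq m] [DecidableEq n] {A B : Matrix (m ⊕ n) (m ⊕ n) R} (h : A * B = 1) :
    A.toBlocks₁₁.det = A.det * B.toBlocks₂₂.det := by
  have hA := Matrix.fromBlocks_toBlocks A
  have hB := Matrix.fromBlocks_toBlocks B
  have hAB : Matrix.fromBlocks (A.toBlocks₁₁ * B.toBlocks₁₁ + A.toBlocks₁₂ * B.toBlocks₂₁)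
      (A.toBlocks₁₁ * B.toBlocks₁₂ + A.toBlocks₁₂ * B.toBlocks₂₂)
      (A.toBlocks₂₁ * B.toBlocks₁₁ + A.toBlocks₂₂ * B.toBlocks₂₁)
      (A.toBlocks₂₁ * B.toBlocks₁₂ + A.toBlocks₂₂ * B.toBlocks₂₂) =
      Matrix.fromBlocks 1 0 0 1 := by
    rw [← Matrix.fromBlocks_multiply, hA, hB, h, Matrix.fromBlocks_one]
  obtain ⟨-, h₁₂, -, h₂₂⟩ := Matrix.fromBlocks_inj.mp hAB
  have hmul : A * Matrix.fromBlocks 1 B.toBlocks₁₂ 0 B.toBlocks₂₂ =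
      Matrix.fromBlocks A.toBlocks₁₁ 0 A.toBlocks₂₁ 1 := by
    rw [← hA, Matrix.fromBlocks_multiply]
    simp [h₁₂, h₂₂]
  have hdet := congrArg Matrix.det hmul
  rw [Matrix.det_mul, Matrix.det_fromBlocks_zero₂₁, Matrix.det_fromBlocks_zero₁₂, Matrix.det_one,
    Matrix.det_one, one_mul, mul_one] at hdet
  exact hdet.symm

/-- The geometric series with ratio `a`. -/
theorem PowerSeries.mk_pow_mul_one_sub {R : Type*} [CommRing R] (a : R) :
    PowerSeries.mk (fun n => a ^ n) * (1 - PowerSeries.C a * PowerSeries.X) = 1 := by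
  have h := congrArg (PowerSeries.rescale a) (PowerSeries.mk_one_mul_one_sub_eq_one R)
  rw [map_mul, map_sub, map_one, PowerSeries.rescale_X] at h
  convert h using 2
  ext n
  simp

/-- The generating function of the complete homogeneous symmetric polynomials. -/
theorem mk_hsymm_eq_prod (σ R : Type*) [CommRing R] [Fintype σ] [DecidableEq σ] :
    PowerSeries.mk (fun n => hsymm σ R n) =
      ∏ i : σ, PowerSeries.mk fun n => (X i : MvPolynomial σ R) ^ n := by
  ext1 n
  rw [PowerSeries.coeff_mk, PowerSeries.coeff_prod, hsymm]
  refine Finset.sum_bij' (fun s _ => Multiset.toFinsupp s.1)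
    (fun f hf => ⟨Finsupp.toMultiset f, ?_⟩) ?_ ?_ ?_ ?_ ?_
  · rw [Finset.mem_finsuppAntidiag] at hf
    rw [Finsupp.card_toMultiset, ← hf.1, Finsupp.sum_fintype _ _ (fun _ => rfl)]
    rfl
  · intro s _
    rw [Finset.mem_finsuppAntidiag]
    exact ⟨(Multiset.sum_count_eq_card fun i _ => Finset.mem_univ i).trans s.2,
      Finset.subset_univ _⟩
  · exact fun _ _ => Finset.mem_univ _
  · intro s _
    ext1
    simp
  · intro f _
    simp
  · intro s _
    rw [Finset.prod_multiset_map_count]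
    simp only [PowerSeries.coeff_mk, Multiset.toFinsupp_apply]
    refine Finset.prod_subset (Finset.subset_univ _) fun i _ hi => ?_
    rw [Multiset.count_eq_zero.mpr (by simpa using hi), pow_zero]

theorem map_mk_hsymm_mul_prod {σ R S : Type*} [CommRing R] [CommRing S] [Fintype σ]
    [DecidableEq σ] (φ : MvPolynomial σ R →+* S) :
    PowerSeries.mk (fun n => φ (hsymm σ R n)) *
      ∏ i : σ, (1 - PowerSeries.C (φ (X i)) * PowerSeries.X) = 1 := by
  have h : PowerSeries.mk (fun n => φ (hsymm σ R n)) =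
      ∏ i : σ, PowerSeries.mk fun n => φ (X i) ^ n := by
    have h := congrArg (PowerSeries.map φ) (mk_hsymm_eq_prod σ R)
    rw [map_prod] at h
    convert h using 1
    · ext; simp
    · refine Finset.prod_congr rfl fun i _ => ?_
      ext; simp
  rw [h, ← Finset.prod_mul_distrib]
  exact Finset.prod_eq_one fun i _ => PowerSeries.mk_pow_mul_one_sub _

theorem PowerSeries.sum_coeff_X_pow_mul {R : Type*} [CommRing R] (f g : PowerSeries R) {n : ℕ}
    (a : Fin n) : ∑ m : Fin n, coeff a (X ^ (m : ℕ) * f) * coeff m g = coeff a (f * g) := by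
  have h := Fin.sum_univ_eq_sum_range (fun m => coeff (a : ℕ) (X ^ m * f) * coeff m g) n
  rw [h, mul_comm f g, coeff_mul, Finset.Nat.sum_antidiagonal_eq_sum_range_succ_mk]
  refine (Finset.sum_subset (Finset.range_subset_range.mpr a.isLt) fun m _ hm => ?_).symm.trans
    (Finset.sum_congr rfl fun m hm => ?_)
  · rw [coeff_X_pow_mul', if_neg (by simpa using hm), zero_mul]
  · rw [coeff_X_pow_mul', if_pos (by simpa [Nat.lt_succ_iff] using hm), mul_comm]

/-- Truncated Toeplitz matrices of inverse power series are inverse to each other. -/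
theorem PowerSeries.toeplitz_mul_toeplitz_eq_one {R : Type*} [CommRing R] {f g : PowerSeries R}
    (h : f * g = 1) (n : ℕ) :
    (Matrix.of fun a b : Fin n => coeff a (X ^ (b : ℕ) * f)) *
      (Matrix.of fun a b : Fin n => coeff a (X ^ (b : ℕ) * g)) = 1 := by
  ext a b
  rw [Matrix.mul_apply]
  simp only [Matrix.of_apply]
  rw [sum_coeff_X_pow_mul, mul_left_comm, h, mul_one, coeff_X_pow, Matrix.one_apply]
  simp [Fin.ext_iff]

theorem PowerSeries.det_toeplitz {R : Type*} [CommRing R] {f : PowerSeries R}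
    (h : constantCoeff f = 1) (n : ℕ) :
    (Matrix.of fun a b : Fin n => coeff a (X ^ (b : ℕ) * f)).det = 1 := by
  rw [Matrix.det_of_isLowerTriangular]
  · simp [coeff_X_pow_mul', h]
  · intro a b hab
    have : a < b := hab
    simp [coeff_X_pow_mul', this]

theorem Polynomial.sum_coeff_mul_coeff_X_pow_mul {R : Type*} [CommRing R] {P : Polynomial R}
    {n : ℕ} (hP : P.natDegree < n) (F : PowerSeries R) (m : ℕ) :
    ∑ k : Fin n, P.coeff k * PowerSeries.coeff m (PowerSeries.X ^ (k : ℕ) * F) =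
      PowerSeries.coeff m ((P : PowerSeries R) * F) := by
  have h : (P : PowerSeries R) =
      ∑ k : Fin n, PowerSeries.C (P.coeff k) * PowerSeries.X ^ (k : ℕ) := by
    conv_lhs => rw [P.as_sum_range_C_mul_X_pow' hP]
    rw [Fin.sum_univ_eq_sum_range (fun k => PowerSeries.C (P.coeff k) * PowerSeries.X ^ k) n,
      ← Polynomial.coeToPowerSeries.ringHom_apply, map_sum]
    simp
  rw [h, Finset.sum_mul, map_sum]
  simp [mul_assoc]

theorem Finset.natDegree_prod_one_add_C_mul_X_le {R ι : Type*} [CommRing R] (s : Finset ι)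
    (y : ι → R) :
    (∏ j ∈ s, (1 + Polynomial.C (y j) * Polynomial.X)).natDegree ≤ s.card := by
  refine (Polynomial.natDegree_prod_le _ _).trans ?_
  rw [card_eq_sum_ones]
  refine sum_le_sum fun j _ => ?_
  compute_degree

/-- If `F` is the inverse of `∏ i, (1 - x i T)`, then the product of the matrices of shifted
coefficients of `F` and of a polynomial `G` has determinant `∏ i, G (x i)`. -/
theorem det_sum_coeff_mul_coeff_eq_prod_eval {R : Type*} [CommRing R] [IsDomain R] {N n : ℕ}
    {x : Fin N → R} (hx : Function.Injective x) {F : PowerSeries R}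
    (hF : F * ∏ i, (1 - PowerSeries.C (x i) * PowerSeries.X) = 1) {G : Polynomial R}
    (hG : G.natDegree + N ≤ n) :
    ((Matrix.of fun (k : Fin N) (m : Fin n) =>
        PowerSeries.coeff m (PowerSeries.X ^ (k : ℕ) * F)) *
      (Matrix.of fun (m : Fin n) (l : Fin N) =>
        PowerSeries.coeff m (PowerSeries.X ^ (l : ℕ) * (G : PowerSeries R)))).det =
      ∏ i, G.eval (x i) := by
  set A := Matrix.of fun (k : Fin N) (m : Fin n) =>
    PowerSeries.coeff m (PowerSeries.X ^ (k : ℕ) * F)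
  set B := Matrix.of fun (m : Fin n) (l : Fin N) =>
    PowerSeries.coeff m (PowerSeries.X ^ (l : ℕ) * (G : PowerSeries R))
  let P : Fin N → Polynomial R := fun i =>
    ∏ l ∈ Finset.univ.erase i, (1 + Polynomial.C (-x l) * Polynomial.X)
  have hPdeg : ∀ i, (P i).natDegree < N := fun i => by
    refine (Finset.natDegree_prod_one_add_C_mul_X_le _ _).trans_lt ?_
    rw [Finset.card_erase_of_mem (Finset.mem_univ i), Finset.card_univ, Fintype.card_fin]
    have := i.isLt
    omega
  have hPF : ∀ i, (P i : PowerSeries R) * F = PowerSeries.mk fun m => x i ^ m := fun i => by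
    have hP : (P i : PowerSeries R) =
        ∏ l ∈ Finset.univ.erase i, (1 - PowerSeries.C (x l) * PowerSeries.X) := by
      rw [← Polynomial.coeToPowerSeries.ringHom_apply, map_prod]
      simp [sub_eq_add_neg]
    rw [← Finset.mul_prod_erase _ _ (Finset.mem_univ i), ← hP] at hF
    linear_combination (P i * F : PowerSeries R) * -PowerSeries.mk_pow_mul_one_sub (x i) +
      PowerSeries.mk (fun m => x i ^ m) * hF
  let U : Matrix (Fin N) (Fin N) R := Matrix.of fun i k => (P i).coeff k
  have hUcoeff : ∀ i (m : ℕ),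
      ∑ k : Fin N, U i k * PowerSeries.coeff m (PowerSeries.X ^ (k : ℕ) * F) = x i ^ m :=
    fun i m => by
      rw [← PowerSeries.coeff_mk m fun m => x i ^ m, ← hPF,
        ← Polynomial.sum_coeff_mul_coeff_X_pow_mul (hPdeg i)]
      rfl
  have hU : U.det = (Matrix.vandermonde x).det := by
    have hF0 : PowerSeries.constantCoeff F = 1 := by
      simpa using congrArg PowerSeries.constantCoeff hF
    have hmul : U * (Matrix.of fun a b : Fin N =>
        PowerSeries.coeff a (PowerSeries.X ^ (b : ℕ) * F)).transpose = Matrix.vandermonde x := by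
      ext i m
      exact hUcoeff i m
    rw [← hmul, Matrix.det_mul, Matrix.det_transpose, PowerSeries.det_toeplitz hF0, mul_one]
  have hUAB : U * (A * B) =
      Matrix.of fun i l => G.eval (x i) * Matrix.vandermonde x i l := by
    rw [← Matrix.mul_assoc]
    ext i l
    rw [Matrix.mul_apply]
    have hUA : ∀ m, (U * A) i m = x i ^ (m : ℕ) := fun m => hUcoeff i m
    have hdeg : (Polynomial.X ^ (l : ℕ) * G).natDegree < n := by
      refine Polynomial.natDegree_mul_le.trans_lt ?_
      have := Polynomial.natDegree_X_pow_le (R := R) (l : ℕ)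
      have := l.isLt
      omega
    have heval := Polynomial.eval_eq_sum_range' hdeg (x i)
    rw [Finset.sum_range] at heval
    calc ∑ m, (U * A) i m * B m l
        = ∑ m : Fin n, (Polynomial.X ^ (l : ℕ) * G).coeff m * x i ^ (m : ℕ) := by
          refine Finset.sum_congr rfl fun m _ => ?_
          rw [hUA, mul_comm, ← Polynomial.coeff_coe]
          simp [B]
      _ = _ := by
          rw [← heval]
          simp [Matrix.vandermonde_apply, mul_comm]
  have hdet := congrArg Matrix.det hUAB
  rw [Matrix.det_mul, Matrix.det_mul_column, hU, mul_comm] at hdet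
  exact mul_right_cancel₀ (Matrix.det_vandermonde_ne_zero_iff.mpr hx) hdet

section Conjugate

variable {N M : ℕ} {l : Fin N → ℕ}

theorem lt_conjF_iff (hl : Antitone l) (i : Fin N) (j : Fin M) :
    (i : ℕ) < conjF l M j ↔ (j : ℕ) < l i :=
  Tuple.lt_card_ge_iff_apply_ge_of_antitone (a := (j : ℕ) + 1) hl

theorem conjF_le (l : Fin N → ℕ) (j : Fin M) : conjF l M j ≤ N :=
  (Finset.card_le_univ _).trans_eq (Fintype.card_fin N)

theorem conjF_antitone (l : Fin N → ℕ) : Antitone (conjF l M) := fun a b hab =>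
  Finset.card_le_card fun i hi => by
    have : (a : ℕ) ≤ b := hab
    simp only [Finset.mem_filter, Finset.mem_univ, true_and] at hi ⊢
    omega

/-- The positions of the vertical steps, then of the horizontal steps, of the boundary path of the
partition `l` inside the `N × M` rectangle. -/
def boundaryPos (hM : ∀ i, l i ≤ M) : Fin N ⊕ Fin M → Fin (N + M) :=
  Sum.elim (fun k => ⟨l k.rev + k, by have := hM k.rev; omega⟩)
    (fun j => ⟨N + j - conjF l M j, by omega⟩)

theorem boundaryPos_inl_lt_iff (hl : Antitone l) (hM : ∀ i, l i ≤ M) (k : Fin N) (j : Fin M) :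
    boundaryPos hM (Sum.inl k) < boundaryPos hM (Sum.inr j) ↔ l k.rev ≤ j := by
  have h := lt_conjF_iff hl k.rev j
  have hN := conjF_le l j
  rw [Fin.val_rev] at h
  simp only [boundaryPos, Sum.elim_inl, Sum.elim_inr, Fin.mk_lt_mk]
  omega

theorem boundaryPos_inl_strictMono (hl : Antitone l) (hM : ∀ i, l i ≤ M) :
    StrictMono fun k => boundaryPos hM (Sum.inl k) := fun a b hab => by
  have h := hl (Fin.rev_le_rev.mpr hab.le)
  have : (a : ℕ) < b := hab
  simp only [boundaryPos, Sum.elim_inl, Fin.mk_lt_mk]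
  omega

theorem boundaryPos_inr_strictMono (hM : ∀ i, l i ≤ M) :
    StrictMono fun j => boundaryPos hM (Sum.inr j) := fun a b hab => by
  have h := conjF_antitone (M := M) l hab.le
  have hN := conjF_le l a
  have : (a : ℕ) < b := hab
  simp only [boundaryPos, Sum.elim_inr, Fin.mk_lt_mk]
  omega

theorem boundaryPos_injective (hl : Antitone l) (hM : ∀ i, l i ≤ M) :
    Function.Injective (boundaryPos hM) := by
  have hne : ∀ k j, boundaryPos hM (Sum.inl k) ≠ boundaryPos hM (Sum.inr j) := fun k j heq => by
    have h := lt_conjF_iff hl k.rev j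
    have hN := conjF_le l j
    rw [Fin.val_rev] at h
    simp only [boundaryPos, Sum.elim_inl, Sum.elim_inr, Fin.mk.injEq] at heq
    omega
  rintro (k | j) (k' | j') h
  · exact congrArg _ ((boundaryPos_inl_strictMono hl hM).injective h)
  · exact (hne _ _ h).elim
  · exact (hne _ _ h.symm).elim
  · exact congrArg _ ((boundaryPos_inr_strictMono hM).injective h)

/-- The permutation carrying the boundary path of the empty partition to that of `l`. -/
noncomputable def boundaryPerm (hl : Antitone l) (hM : ∀ i, l i ≤ M) :
    Equiv.Perm (Fin (N + M)) :=
  Equiv.ofBijective (boundaryPos hM ∘ finSumFinEquiv.symm)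
    (Finite.injective_iff_bijective.mp
      ((boundaryPos_injective hl hM).comp finSumFinEquiv.symm.injective))

theorem boundaryPerm_castAdd (hl : Antitone l) (hM : ∀ i, l i ≤ M) (k : Fin N) :
    boundaryPerm hl hM (Fin.castAdd M k) = boundaryPos hM (Sum.inl k) := by
  simp [boundaryPerm]

theorem boundaryPerm_natAdd (hl : Antitone l) (hM : ∀ i, l i ≤ M) (j : Fin M) :
    boundaryPerm hl hM (Fin.natAdd N j) = boundaryPos hM (Sum.inr j) := by
  simp [boundaryPerm]

theorem sign_boundaryPerm (hl : Antitone l) (hM : ∀ i, l i ≤ M) :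
    Equiv.Perm.sign (boundaryPerm hl hM) = ∏ k, (-1) ^ l k := by
  rw [Equiv.Perm.sign_eq_prod_prod_Iio]
  simp only [← Finset.filter_gt_eq_Iio, Finset.prod_filter]
  rw [Fin.prod_univ_add]
  simp only [Fin.prod_univ_add, boundaryPerm_castAdd, boundaryPerm_natAdd,
    boundaryPos_inl_lt_iff hl hM,
    (boundaryPos_inl_strictMono hl hM).lt_iff_lt, (boundaryPos_inr_strictMono hM).lt_iff_lt]
  have h₁ : ∀ k k' : Fin N, (if Fin.castAdd M k' < Fin.castAdd M k then
      (if k' < k then (1 : ℤˣ) else -1) else 1) = 1 := fun k k' => by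
    simp only [Fin.lt_def, Fin.val_castAdd]
    split_ifs <;> rfl
  have h₂ : ∀ (k : Fin N) (j : Fin M), ¬ Fin.natAdd N j < Fin.castAdd M k := fun k j => by
    simp only [Fin.lt_def, Fin.val_castAdd, Fin.val_natAdd]
    omega
  have h₃ : ∀ (k : Fin N) (j : Fin M), Fin.castAdd M k < Fin.natAdd N j := fun k j => by
    simp only [Fin.lt_def, Fin.val_castAdd, Fin.val_natAdd]
    omega
  have h₄ : ∀ j j' : Fin M, (if Fin.natAdd N j' < Fin.natAdd N j then
      (if j' < j then (1 : ℤˣ) else -1) else 1) = 1 := fun j j' => by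
    simp only [Fin.lt_def, Fin.val_natAdd]
    split_ifs <;> first | rfl | omega
  simp only [h₁, h₂, h₃, h₄, if_false, if_true, Finset.prod_const_one, mul_one, one_mul]
  rw [Finset.prod_comm, ← Equiv.prod_comp Fin.revPerm]
  refine Finset.prod_congr rfl fun k _ => ?_
  simp only [Fin.revPerm_apply, Fin.rev_rev]
  rw [Finset.prod_ite, Finset.prod_const_one, one_mul, Finset.prod_const]
  congr 1
  simp only [not_le]
  rw [Fin.card_filter_val_lt, min_eq_right (hM k)]

/-- The dual Jacobi–Trudi identity for a pair of mutually inverse power series. -/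
theorem det_coeff_boundaryPos {R : Type*} [CommRing R] {f g : PowerSeries R} (hgf : g * f = 1)
    (hg : PowerSeries.constantCoeff g = 1) (hl : Antitone l) (hM : ∀ i, l i ≤ M) :
    (Matrix.of fun k k' : Fin N =>
      PowerSeries.coeff (l k.rev + k) (PowerSeries.X ^ (k' : ℕ) * g)).det =
    (∏ k, (-1) ^ l k) * (Matrix.of fun j j' : Fin M =>
      PowerSeries.coeff (N + j') (PowerSeries.X ^ (N + j - conjF l M j) * f)).det := by
  let e : Fin N ⊕ Fin M ≃ Fin (N + M) := finSumFinEquiv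
  let T : PowerSeries R → Matrix (Fin (N + M)) (Fin (N + M)) R := fun h =>
    Matrix.of fun a b => PowerSeries.coeff a (PowerSeries.X ^ (b : ℕ) * h)
  let π := boundaryPerm hl hM
  have hAB : ((T g).submatrix π id).submatrix e e * ((T f).submatrix id π).submatrix e e = 1 := by
    rw [Matrix.submatrix_mul_equiv, ← Matrix.submatrix_mul _ _ _ _ _ Function.bijective_id,
      PowerSeries.toeplitz_mul_toeplitz_eq_one hgf, Matrix.submatrix_one_equiv,
      Matrix.submatrix_one_equiv]
  have h := Matrix.det_toBlocks₁₁_of_mul_eq_one hAB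
  rw [Matrix.det_submatrix_equiv_self, Matrix.det_permute, PowerSeries.det_toeplitz hg, mul_one,
    sign_boundaryPerm] at h
  convert h using 2
  · ext k k'
    simp [Matrix.toBlocks₁₁, T, π, e, boundaryPerm_castAdd, boundaryPos]
  · simp
  · rw [← Matrix.det_transpose]
    congr 1
    ext j j'
    simp [Matrix.toBlocks₂₂, T, π, e, boundaryPerm_natAdd, boundaryPos]

end Conjugate

theorem map_hz {σ S : Type*} [Fintype σ] [DecidableEq σ] [CommRing S]
    (φ : MvPolynomial σ ℚ →+* S) {n : ℤ} {a b : ℕ} (h : n = a - b) :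
    φ (hz σ n) = PowerSeries.coeff a
      (PowerSeries.X ^ b * PowerSeries.mk fun n => φ (hsymm σ ℚ n)) := by
  subst h
  rw [PowerSeries.coeff_X_pow_mul', PowerSeries.coeff_mk, hz]
  by_cases hab : b ≤ a
  · rw [if_pos hab, if_pos (by omega), Int.toNat_sub]
  · rw [if_neg hab, if_neg (by omega), map_zero]

theorem map_schur {σ S : Type*} [Fintype σ] [DecidableEq σ] [CommRing S]
    (φ : MvPolynomial σ ℚ →+* S) {N : ℕ} (l : Fin N → ℕ) :
    φ (schur σ l) = (Matrix.of fun k k' : Fin N => PowerSeries.coeff (l k.rev + k)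
      (PowerSeries.X ^ (k' : ℕ) * PowerSeries.mk fun n => φ (hsymm σ ℚ n))).det := by
  rw [schur, RingHom.map_det, ← Matrix.det_submatrix_equiv_self Fin.revPerm]
  congr 1
  ext k k'
  refine map_hz φ ?_
  simp only [Fin.revPerm_apply, Fin.val_rev]
  omega

theorem map_schur_conjF {σ S : Type*} [Fintype σ] [DecidableEq σ] [CommRing S]
    (φ : MvPolynomial σ ℚ →+* S) {N M : ℕ} (l : Fin N → ℕ) :
    φ (schur σ (conjF l M)) = (Matrix.of fun j j' : Fin M => PowerSeries.coeff (N + j')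
      (PowerSeries.X ^ (N + j - conjF l M j) *
        PowerSeries.mk fun n => φ (hsymm σ ℚ n))).det := by
  rw [schur, RingHom.map_det]
  congr 1
  ext j j'
  refine map_hz φ ?_
  have := conjF_le l j
  omega

/-- The dual Jacobi–Trudi identity for Schur polynomials. -/
theorem map_schur_conjF_eq_det_coeff_prod {S σ : Type*} [Fintype σ] [DecidableEq σ] [CommRing S]
    (φ : MvPolynomial σ ℚ →+* S) {N M : ℕ} {l : Fin N → ℕ} (hl : Antitone l)
    (hM : ∀ i, l i ≤ M) :
    φ (schur σ (conjF l M)) = (Matrix.of fun k k' : Fin N =>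
      PowerSeries.coeff (l k.rev + k) (PowerSeries.X ^ (k' : ℕ) *
        ∏ i : σ, (1 + PowerSeries.C (φ (X i)) * PowerSeries.X))).det := by
  set g : PowerSeries S := ∏ i : σ, (1 - PowerSeries.C (φ (X i)) * PowerSeries.X)
  have hgf : g * PowerSeries.mk (fun n => φ (hsymm σ ℚ n)) = 1 := by
    rw [mul_comm, map_mk_hsymm_mul_prod]
  have hg : PowerSeries.constantCoeff g = 1 := by simp [g, map_prod]
  have hrescale : ∏ i : σ, (1 + PowerSeries.C (φ (X i)) * PowerSeries.X) =
      PowerSeries.rescale (-1) g := by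
    rw [map_prod]
    refine Finset.prod_congr rfl fun i _ => ?_
    ext n
    rcases n with _ | _ | n <;>
      simp [PowerSeries.coeff_rescale, PowerSeries.coeff_one]
  have hcoeff : ∀ a b : ℕ, PowerSeries.coeff a (PowerSeries.X ^ b * PowerSeries.rescale (-1) g) =
      (-1) ^ a * ((-1) ^ b * PowerSeries.coeff a (PowerSeries.X ^ b * g)) := fun a b => by
    rw [PowerSeries.coeff_X_pow_mul', PowerSeries.coeff_X_pow_mul']
    split_ifs with hab
    · obtain ⟨c, rfl⟩ := Nat.exists_eq_add_of_le hab
      rw [PowerSeries.coeff_rescale, Nat.add_sub_cancel_left, ← mul_assoc, ← pow_add]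
      congr 1
      rw [show b + c + b = 2 * b + c by ring, pow_add, pow_mul]
      simp
    · simp
  have hrow := Matrix.det_mul_row (fun k' : Fin N => (-1 : S) ^ (k' : ℕ))
    (Matrix.of fun k k' : Fin N =>
      PowerSeries.coeff (l k.rev + k) (PowerSeries.X ^ (k' : ℕ) * g))
  have hcol := Matrix.det_mul_column (fun k : Fin N => (-1 : S) ^ (l k.rev + k))
    (Matrix.of fun k k' : Fin N => (-1 : S) ^ (k' : ℕ) *
      PowerSeries.coeff (l k.rev + k) (PowerSeries.X ^ (k' : ℕ) * g))
  have hrev : ∏ k : Fin N, (-1 : S) ^ l k.rev = ∏ k, (-1) ^ l k :=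
    Equiv.prod_comp Fin.revPerm fun k => (-1 : S) ^ l k
  have hsq : ∀ {ι : Type} [Fintype ι] (e : ι → ℕ),
      (∏ k, (-1 : S) ^ e k) * ∏ k, (-1 : S) ^ e k = 1 := fun e => by
    rw [← Finset.prod_mul_distrib]
    exact Finset.prod_eq_one fun k _ => by rw [← mul_pow]; simp
  simp only [Matrix.of_apply] at hrow hcol
  simp only [hrescale, hcoeff]
  rw [hcol, hrow, det_coeff_boundaryPos hgf hg hl hM, ← map_schur_conjF]
  simp only [pow_add, Finset.prod_mul_distrib]
  rw [hrev]
  linear_combination (-φ (schur σ (conjF l M))) * hsq l -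
    φ (schur σ (conjF l M)) * (∏ k, (-1 : S) ^ l k) * (∏ k, (-1 : S) ^ l k) *
      hsq fun k : Fin N => (k : ℕ)

/-- Partitions in a rectangle correspond to strictly monotone sequences of boundary positions. -/
theorem sum_strictMono_eq_sum_partitionsLE {S : Type*} [AddCommMonoid S] {N M : ℕ}
    (f : (Fin N → ℕ) → S) :
    ∑ p : Fin N → Fin (N + M) with StrictMono p, f (fun k => p k) =
      ∑ l ∈ partitionsLE N M, f fun k => l k.rev + k := by
  have hmem : ∀ {l : Fin N → ℕ}, l ∈ partitionsLE N M ↔ (∀ i, l i ≤ M) ∧ Antitone l := by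
    intro l
    simp only [partitionsLE, Finset.mem_filter, Fintype.mem_piFinset, Finset.mem_range,
      Nat.lt_succ_iff]
    rfl
  have hgap : ∀ {p : Fin N → Fin (N + M)}, StrictMono p → ∀ {a b : Fin N}, a ≤ b →
      (p a : ℕ) + b ≤ p b + a := by
    intro p hp a b hab
    obtain ⟨d, hd⟩ := Nat.exists_eq_add_of_le (show (a : ℕ) ≤ b from hab)
    induction d generalizing b with
    | zero =>
      obtain rfl : b = a := Fin.ext hd
      rfl
    | succ d ih =>
      have hlt : (⟨a + d, by omega⟩ : Fin N) < b := by
        rw [Fin.lt_def]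
        dsimp only
        omega
      have h₁ := ih (b := ⟨a + d, by omega⟩) (by rw [Fin.le_def]; dsimp only; omega) rfl
      have h₂ : ((p ⟨a + d, by omega⟩ : Fin (N + M)) : ℕ) < p b := hp hlt
      dsimp only at h₁
      omega
  have hle : ∀ {p : Fin N → Fin (N + M)}, StrictMono p → ∀ k : Fin N, (k : ℕ) ≤ p k := by
    intro p hp k
    have h := hgap hp (show (⟨0, k.pos⟩ : Fin N) ≤ k from Nat.zero_le _)
    dsimp only at h
    omega
  symm
  refine Finset.sum_bij
    (fun l hl => fun k => boundaryPos (hmem.mp hl).1 (Sum.inl k)) ?_ ?_ ?_ ?_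
  · intro l hl
    rw [Finset.mem_filter]
    exact ⟨Finset.mem_univ _, boundaryPos_inl_strictMono (hmem.mp hl).2 _⟩
  · intro l _ l' _ h
    ext i
    have := congrFun h i.rev
    simpa [boundaryPos] using this
  · intro p hp
    replace hp := (Finset.mem_filter.mp hp).2
    refine ⟨fun i => p i.rev - i.rev, hmem.mpr ⟨fun i => ?_, fun i j hij => ?_⟩, ?_⟩
    · have h := hgap hp (show i.rev ≤ ⟨N - 1, Nat.sub_lt i.pos one_pos⟩ by
        rw [Fin.le_def, Fin.val_rev]; dsimp only; omega)
      have := (p ⟨N - 1, Nat.sub_lt i.pos one_pos⟩).isLt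
      dsimp only at h
      omega
    · have h := hgap hp (Fin.rev_le_rev.mpr hij)
      dsimp only
      omega
    · ext k
      have := hle hp k
      simp only [boundaryPos, Sum.elim_inl, Fin.rev_rev]
      omega
  · intro l _
    rfl

/-- Dual Cauchy identity:
`∏_{i,j} (1 + x_i y_j) = Σ_λ s_λ(x) s_{λ'}(y)`, summing over partitions `λ`
fitting in an `N × M` rectangle. -/
theorem dual_cauchy_identity (N M : ℕ) :
    (∏ i : Fin N, ∏ j : Fin M,
        (1 + X (Sum.inl i) * X (Sum.inr j) : MvPolynomial (Fin N ⊕ Fin M) ℚ))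
      = ∑ l ∈ partitionsLE N M,
          rename Sum.inl (schur (Fin N) l) *
            rename Sum.inr (schur (Fin M) (conjF l M)) := by
  let φ : MvPolynomial (Fin N) ℚ →+* MvPolynomial (Fin N ⊕ Fin M) ℚ :=
    (rename Sum.inl).toRingHom
  let ψ : MvPolynomial (Fin M) ℚ →+* MvPolynomial (Fin N ⊕ Fin M) ℚ :=
    (rename Sum.inr).toRingHom
  let F : PowerSeries (MvPolynomial (Fin N ⊕ Fin M) ℚ) :=
    PowerSeries.mk fun n => φ (hsymm (Fin N) ℚ n)
  let G : Polynomial (MvPolynomial (Fin N ⊕ Fin M) ℚ) :=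
    ∏ j : Fin M, (1 + Polynomial.C (ψ (X j)) * Polynomial.X)
  have hGcoe : (G : PowerSeries (MvPolynomial (Fin N ⊕ Fin M) ℚ)) =
      ∏ j : Fin M, (1 + PowerSeries.C (ψ (X j)) * PowerSeries.X) := by
    rw [← Polynomial.coeToPowerSeries.ringHom_apply, map_prod]
    simp
  have hGdeg : G.natDegree + N ≤ N + M := by
    have h := Finset.natDegree_prod_one_add_C_mul_X_le Finset.univ fun j : Fin M => ψ (X j)
    rw [Finset.card_univ, Fintype.card_fin] at h
    have h' : G.natDegree ≤ M := h
    omega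
  have hinj : Function.Injective fun i : Fin N => φ (X i) := fun i j hij => by
    simpa [φ] using hij
  have hdet := det_sum_coeff_mul_coeff_eq_prod_eval hinj (map_mk_hsymm_mul_prod φ) hGdeg
  have heval : ∀ i, G.eval (φ (X i)) =
      ∏ j : Fin M, (1 + X (Sum.inl i) * X (Sum.inr j)) := fun i => by
    rw [Polynomial.eval_prod]
    refine Finset.prod_congr rfl fun j _ => ?_
    have hx : φ (X i) = X (Sum.inl i) := rename_X _ _
    have hy : ψ (X j) = X (Sum.inr j) := rename_X _ _
    rw [hx, hy, mul_comm (X (Sum.inl i))]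
    simp
  rw [← Finset.prod_congr rfl fun i _ => heval i, ← hdet, Matrix.det_mul_eq_sum_strictMono]
  refine (sum_strictMono_eq_sum_partitionsLE (M := M) fun p : Fin N → ℕ =>
    (Matrix.of fun k' k : Fin N => PowerSeries.coeff (p k) (PowerSeries.X ^ (k' : ℕ) * F)).det *
      (Matrix.of fun k k' : Fin N =>
        PowerSeries.coeff (p k) (PowerSeries.X ^ (k' : ℕ) * (G : PowerSeries _))).det).trans
    (Finset.sum_congr rfl fun l hl => ?_)
  simp only [partitionsLE, Finset.mem_filter, Fintype.mem_piFinset, Finset.mem_range,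
    Nat.lt_succ_iff] at hl
  have hx : rename Sum.inl (schur (Fin N) l) = φ (schur (Fin N) l) := rfl
  have hy : rename Sum.inr (schur (Fin M) (conjF l M)) = ψ (schur (Fin M) (conjF l M)) := rfl
  rw [hx, hy, map_schur, map_schur_conjF_eq_det_coeff_prod ψ hl.2 hl.1, hGcoe,
    ← Matrix.det_transpose]
  rfl
end

section
/- Duality for moments of the determinant in the chiral (Laguerre) β-Ensembles: for β > 0, β' = 4/β, γ > −1 and γ' = 2(γ+1)/β − 1 > −1, one has ⟨(x₁···x_N)^n⟩_{chβE^γ_N} = (β/2)^{nN} ⟨(x₁···x_n)^N⟩_{chβ'E^{γ'}_n}. -/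
open MeasureTheory

/-- The average of `f` over the chiral (Laguerre) β-Ensemble of `N`
eigenvalues, with joint density proportional to
`∏_{i<j}|x_i−x_j|^β ∏_i x_i^γ e^{−x_i}` on `(0,∞)^N`. -/
noncomputable def chAvg (N : ℕ) (β γ : ℝ) (f : (Fin N → ℝ) → ℝ) : ℝ :=
  (∫ x : Fin N → ℝ in {x | ∀ i, 0 < x i}, f x *
      ((∏ i, ∏ j ∈ Finset.Ioi i, |x i - x j| ^ β) *
        ∏ i, x i ^ γ * Real.exp (-(x i)))) /
  (∫ x : Fin N → ℝ in {x | ∀ i, 0 < x i},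
      (∏ i, ∏ j ∈ Finset.Ioi i, |x i - x j| ^ β) *
        ∏ i, x i ^ γ * Real.exp (-(x i)))

open Set Filter Topology

/-- Lebesgue measure on the open orthant `(0,∞)^N`. -/
noncomputable def orthantMeasure (N : ℕ) : Measure (Fin N → ℝ) :=
  Measure.pi fun _ => volume.restrict (Ioi (0 : ℝ))

lemma orthantMeasure_eq_restrict (N : ℕ) :
    orthantMeasure N = volume.restrict {x : Fin N → ℝ | ∀ i, 0 < x i} := by
  rw [orthantMeasure, ← Measure.restrict_pi_pi, volume_pi]
  congr 1
  ext x
  simp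

lemma measurableSet_orthant (N : ℕ) : MeasurableSet {x : Fin N → ℝ | ∀ i, 0 < x i} := by
  rw [ofPred_forall]
  exact MeasurableSet.iInter fun i => measurableSet_lt measurable_const (measurable_pi_apply i)

lemma ae_pos_orthantMeasure (N : ℕ) : ∀ᵐ x ∂orthantMeasure N, ∀ i, 0 < x i := by
  rw [orthantMeasure_eq_restrict]
  exact ae_restrict_mem (measurableSet_orthant N)

lemma integral_comp_swap_orthantMeasure {N : ℕ} (i j : Fin N) (f : (Fin N → ℝ) → ℝ) :
    ∫ x, f (x ∘ Equiv.swap i j) ∂orthantMeasure N = ∫ x, f x ∂orthantMeasure N := by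
  have h := measurePreserving_arrowCongr' (fun _ : Fin N => volume.restrict (Ioi (0 : ℝ)))
    (fun _ : Fin N => volume.restrict (Ioi (0 : ℝ))) (Equiv.swap i j) (MeasurableEquiv.refl ℝ)
    (fun _ => MeasurePreserving.id _)
  have h2 := h.integral_comp' f
  rw [orthantMeasure, ← h2]
  congr 1

/-- The integral over the orthant of a partial derivative vanishes when the primitive vanishes on
the corresponding face. -/
lemma integral_orthantMeasure_eq_zero_of_hasDerivAt {N : ℕ} (i : Fin N)
    {f f' : (Fin N → ℝ) → ℝ} (hf : Integrable f (orthantMeasure N))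
    (hf' : Integrable f' (orthantMeasure N))
    (hd : ∀ x, (∀ k, 0 < x k) → HasDerivAt (fun s => f (Function.update x i s)) (f' x) (x i))
    (hc : ∀ x, (∀ k, 0 < x k) →
      ContinuousWithinAt (fun s => f (Function.update x i s)) (Ici 0) 0)
    (h0 : ∀ x, x i = 0 → f x = 0) :
    ∫ x, f' x ∂orthantMeasure N = 0 := by
  obtain _ | n := N
  · exact i.elim0
  have hmp := (measurePreserving_piFinSuccAbove
    (fun _ : Fin (n + 1) => volume.restrict (Ioi (0 : ℝ))) i).symm
  have hInt : ∀ g : (Fin (n + 1) → ℝ) → ℝ, Integrable g (orthantMeasure (n + 1)) →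
      Integrable (fun p : ℝ × (Fin n → ℝ) => g (i.insertNth p.1 p.2))
        ((volume.restrict (Ioi (0 : ℝ))).prod (orthantMeasure n)) := fun g hg =>
    (hmp.integrable_comp_emb (MeasurableEquiv.measurableEmbedding _)).2 hg
  have hF := hInt f hf
  have hF' := hInt f' hf'
  have : SigmaFinite (orthantMeasure n) := by unfold orthantMeasure; infer_instance
  rw [orthantMeasure, ← hmp.integral_comp']
  change ∫ p : ℝ × (Fin n → ℝ), f' (i.insertNth p.1 p.2)
    ∂((volume.restrict (Ioi (0 : ℝ))).prod (orthantMeasure n)) = 0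
  rw [integral_prod_symm _ hF']
  refine integral_eq_zero_of_ae ?_
  filter_upwards [ae_pos_orthantMeasure n, hF.prod_left_ae, hF'.prod_left_ae] with y hy h1 h2
  have hpos : ∀ t : ℝ, 0 < t → ∀ k, 0 < (i.insertNth t y : Fin (n + 1) → ℝ) k := by
    intro t ht k
    rcases Fin.eq_self_or_eq_succAbove i k with rfl | ⟨j, rfl⟩
    · simpa using ht
    · simpa using hy j
  have hder : ∀ t ∈ Ioi (0 : ℝ), HasDerivAt (fun s => f (i.insertNth s y))
      (f' (i.insertNth t y)) t := by
    intro t ht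
    simpa [Fin.update_insertNth] using hd _ (hpos t ht)
  have hlim := tendsto_zero_of_hasDerivAt_of_integrableOn_Ioi hder h2 h1
  have hcont : ContinuousWithinAt (fun s => f (i.insertNth s y)) (Ici 0) 0 := by
    simpa [Fin.update_insertNth] using hc _ (hpos 1 one_pos)
  rw [integral_Ioi_of_hasDerivAt_of_tendsto hcont hder h2 hlim, h0 _ (by simp)]
  simp

/-- The one-particle Laguerre factors of the chiral β-Ensemble. -/
noncomputable def laguerreWeight {N : ℕ} (γ : ℝ) (x : Fin N → ℝ) : ℝ :=
  ∏ k, x k ^ γ * Real.exp (-(x k))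

/-- The regularized Vandermonde factor `∏_{i<j} ((x_i - x_j)^2 + ε)^(β/2)`, written as a product
over ordered pairs. -/
noncomputable def vandermondeReg {N : ℕ} (β ε : ℝ) (x : Fin N → ℝ) : ℝ :=
  ∏ a, ∏ b ∈ {a}ᶜ, ((x b - x a) ^ 2 + ε) ^ (β / 4)

lemma measurable_laguerreWeight {N : ℕ} (γ : ℝ) :
    Measurable (laguerreWeight γ : (Fin N → ℝ) → ℝ) := by
  unfold laguerreWeight
  fun_prop

lemma measurable_vandermondeReg {N : ℕ} (β ε : ℝ) :
    Measurable (vandermondeReg β ε : (Fin N → ℝ) → ℝ) := by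
  unfold vandermondeReg
  fun_prop

lemma laguerreWeight_nonneg {N : ℕ} (γ : ℝ) {x : Fin N → ℝ} (hx : ∀ k, 0 < x k) :
    0 ≤ laguerreWeight γ x :=
  Finset.prod_nonneg fun k _ => mul_nonneg (Real.rpow_nonneg (hx k).le _) (Real.exp_pos _).le

lemma laguerreWeight_add_natCast {N : ℕ} (γ : ℝ) (n : ℕ) {x : Fin N → ℝ} (hx : ∀ k, 0 < x k) :
    laguerreWeight (γ + n) x = (∏ k, x k ^ n) * laguerreWeight γ x := by
  rw [laguerreWeight, laguerreWeight, ← Finset.prod_mul_distrib]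
  refine Finset.prod_congr rfl fun k _ => ?_
  rw [Real.rpow_add (hx k), Real.rpow_natCast]
  ring

lemma vandermondeReg_nonneg {N : ℕ} (β : ℝ) {ε : ℝ} (hε : 0 ≤ ε) (x : Fin N → ℝ) :
    0 ≤ vandermondeReg β ε x :=
  Finset.prod_nonneg fun _ _ => Finset.prod_nonneg fun _ _ => Real.rpow_nonneg (by positivity) _

lemma vandermondeReg_zero {N : ℕ} (β : ℝ) (x : Fin N → ℝ) :
    vandermondeReg β 0 x = ∏ i, ∏ j ∈ Finset.Ioi i, |x i - x j| ^ β := by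
  have key : ∀ i j, ((x i - x j) ^ 2 + 0) ^ (β / 4) = |x i - x j| ^ (β / 2) := by
    intro i j
    rw [add_zero, ← sq_abs, ← Real.rpow_natCast, ← Real.rpow_mul (abs_nonneg _)]
    congr 1
    push_cast
    ring
  unfold vandermondeReg
  simp_rw [key]
  rw [← Finset.prod_prod_Ioi_mul_eq_prod_prod_off_diag (fun i j => |x i - x j| ^ (β / 2))]
  refine Finset.prod_congr rfl fun i _ => Finset.prod_congr rfl fun j _ => ?_
  rw [abs_sub_comm (x j) (x i),
    ← Real.mul_rpow (abs_nonneg _) (abs_nonneg _), ← sq, ← Real.rpow_natCast,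
    ← Real.rpow_mul (abs_nonneg _)]
  congr 1
  push_cast
  ring

lemma laguerreWeight_comp {N : ℕ} (γ : ℝ) (σ : Equiv.Perm (Fin N)) (x : Fin N → ℝ) :
    laguerreWeight γ (x ∘ σ) = laguerreWeight γ x :=
  Equiv.prod_comp σ fun k => x k ^ γ * Real.exp (-(x k))

lemma vandermondeReg_comp {N : ℕ} (β ε : ℝ) (σ : Equiv.Perm (Fin N)) (x : Fin N → ℝ) :
    vandermondeReg β ε (x ∘ σ) = vandermondeReg β ε x := by
  unfold vandermondeReg
  rw [← Equiv.prod_comp σ fun a => ∏ b ∈ {a}ᶜ, ((x b - x a) ^ 2 + ε) ^ (β / 4)]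
  refine Finset.prod_congr rfl fun a _ => ?_
  exact Finset.prod_equiv σ (by simp) (by simp)

lemma one_le_prod_one_add {N : ℕ} {x : Fin N → ℝ} (hx : ∀ k, 0 < x k) :
    1 ≤ ∏ k, (1 + x k) :=
  Finset.one_le_prod fun k _ => by linarith [hx k]

lemma one_add_le_prod_one_add {N : ℕ} {x : Fin N → ℝ} (hx : ∀ k, 0 < x k) (i : Fin N) :
    1 + x i ≤ ∏ k, (1 + x k) := by
  rw [← Finset.mul_prod_erase _ _ (Finset.mem_univ i)]
  exact le_mul_of_one_le_right (by linarith [hx i])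
    (Finset.one_le_prod fun k _ => by linarith [hx k])

lemma abs_sub_le_prod_one_add {N : ℕ} {x : Fin N → ℝ} (hx : ∀ k, 0 < x k) (i j : Fin N) :
    |x i - x j| ≤ ∏ k, (1 + x k) := by
  have h1 := one_add_le_prod_one_add hx i
  have h2 := one_add_le_prod_one_add hx j
  rw [abs_le]
  constructor <;> linarith [hx i, hx j]

lemma exists_vandermondeReg_le (N : ℕ) {β : ℝ} (hβ : 0 < β) :
    ∃ M : ℕ, ∀ ε, 0 ≤ ε → ε ≤ 1 → ∀ x : Fin N → ℝ, (∀ k, 0 < x k) →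
      vandermondeReg β ε x ≤ (∏ k, (1 + x k)) ^ M := by
  obtain ⟨m, hm⟩ := exists_nat_ge (β / 4)
  refine ⟨∑ a : Fin N, ∑ b ∈ ({a}ᶜ : Finset (Fin N)), 2 * m, fun ε h0 h1 x hx => ?_⟩
  have hP := one_le_prod_one_add hx
  rw [vandermondeReg, ← Finset.prod_pow_eq_pow_sum]
  refine Finset.prod_le_prod
    (fun _ _ => Finset.prod_nonneg fun _ _ => Real.rpow_nonneg (by positivity) _) fun a _ => ?_
  rw [← Finset.prod_pow_eq_pow_sum]
  refine Finset.prod_le_prod (fun _ _ => Real.rpow_nonneg (by positivity) _) fun b _ => ?_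
  set P := ∏ k, (1 + x k)
  have ha := one_add_le_prod_one_add hx a
  have hb := one_add_le_prod_one_add hx b
  have hsq : (x b - x a) ^ 2 + ε ≤ P ^ 2 := by
    have : (x b - x a) ^ 2 ≤ (P - 1) ^ 2 :=
      sq_le_sq' (by linarith [hx a, hx b]) (by linarith [hx a, hx b])
    nlinarith
  calc ((x b - x a) ^ 2 + ε) ^ (β / 4) ≤ (P ^ 2) ^ (β / 4) :=
        Real.rpow_le_rpow (by positivity) hsq (by positivity)
    _ ≤ (P ^ 2) ^ (m : ℝ) := Real.rpow_le_rpow_of_exponent_le (one_le_pow₀ hP) hm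
    _ = P ^ (2 * m) := by rw [Real.rpow_natCast, pow_mul]

lemma integrableOn_one_add_pow_mul_laguerre (M : ℕ) {γ : ℝ} (hγ : -1 < γ) :
    IntegrableOn (fun t : ℝ => (1 + t) ^ M * (t ^ γ * Real.exp (-t))) (Ioi 0) := by
  induction M generalizing γ with
  | zero =>
    refine (Real.GammaIntegral_convergent (s := γ + 1) (by linarith)).congr_fun
      (fun t _ => ?_) measurableSet_Ioi
    simp only [add_sub_cancel_right, pow_zero, one_mul]
    ring
  | succ M ih =>
    refine ((ih hγ).add (ih (γ := γ + 1) (by linarith))).congr_fun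
      (fun t ht => ?_) measurableSet_Ioi
    simp only [Pi.add_apply, Real.rpow_add_one (ne_of_gt ht)]
    ring

lemma integrable_prod_one_add_pow_mul_laguerreWeight (N M : ℕ) {γ : ℝ} (hγ : -1 < γ) :
    Integrable (fun x : Fin N → ℝ => (∏ k, (1 + x k)) ^ M * laguerreWeight γ x)
      (orthantMeasure N) := by
  have h := Integrable.fintype_prod (ι := Fin N) (𝕜 := ℝ)
    (μ := fun _ => volume.restrict (Ioi (0 : ℝ)))
    (f := fun _ t => (1 + t) ^ M * (t ^ γ * Real.exp (-t)))
    (fun _ => integrableOn_one_add_pow_mul_laguerre M hγ)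
  refine h.congr (Eventually.of_forall fun x => ?_)
  simp only [laguerreWeight, ← Finset.prod_pow, ← Finset.prod_mul_distrib]

/-- Measurable functions of polynomial growth are integrable against the Laguerre weight. -/
lemma integrable_mul_laguerreWeight {N : ℕ} {γ : ℝ} (hγ : -1 < γ) {g : (Fin N → ℝ) → ℝ}
    (hg : Measurable g) (C : ℝ) (M : ℕ)
    (hb : ∀ x, (∀ k, 0 < x k) → |g x| ≤ C * (∏ k, (1 + x k)) ^ M) :
    Integrable (fun x => g x * laguerreWeight γ x) (orthantMeasure N) := by
  refine ((integrable_prod_one_add_pow_mul_laguerreWeight N M hγ).const_mul C).mono'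
    (hg.mul (measurable_laguerreWeight γ)).aestronglyMeasurable ?_
  filter_upwards [ae_pos_orthantMeasure N] with x hx
  rw [Real.norm_eq_abs, abs_mul, abs_of_nonneg (laguerreWeight_nonneg γ hx), ← mul_assoc]
  exact mul_le_mul_of_nonneg_right (hb x hx) (laguerreWeight_nonneg γ hx)

lemma hasDerivAt_vandermondeReg {N : ℕ} (β : ℝ) {ε : ℝ} (hε : 0 < ε) (i : Fin N)
    (x : Fin N → ℝ) (s : ℝ) :
    HasDerivAt (fun s => vandermondeReg β ε (Function.update x i s))
      (vandermondeReg β ε (Function.update x i s) *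
        (β * ∑ j, (Function.update x i s i - Function.update x i s j) /
          ((Function.update x i s i - Function.update x i s j) ^ 2 + ε))) s := by
  have hpos : ∀ (y : Fin N → ℝ) a b, 0 < (y b - y a) ^ 2 + ε := fun y a b => by positivity
  have hexp : ∀ y : Fin N → ℝ, vandermondeReg β ε y =
      Real.exp (∑ a, ∑ b ∈ {a}ᶜ, Real.log ((y b - y a) ^ 2 + ε) * (β / 4)) := by
    intro y
    simp only [vandermondeReg, Real.exp_sum, Real.rpow_def_of_pos (hpos y _ _)]
  have hu : ∀ k, HasDerivAt (fun s => Function.update x i s k) ((Pi.single i 1 : Fin N → ℝ) k) s :=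
    hasDerivAt_pi.1 (hasDerivAt_update x i s)
  have hd := (HasDerivAt.fun_sum (u := Finset.univ) fun a _ =>
    HasDerivAt.fun_sum (u := ({a}ᶜ : Finset (Fin N))) fun b _ =>
      (((((hu b).sub (hu a)).pow 2).add_const ε).log (hpos _ a b).ne').mul_const (β / 4)).exp
  simp only [Pi.sub_apply, Pi.pow_apply] at hd
  simp only [hexp]
  convert hd using 2
  set y := Function.update x i s
  have hsplit : ∀ a, ∑ b ∈ ({a}ᶜ : Finset (Fin N)),
      ((2 : ℕ) * (y b - y a) ^ (2 - 1) *
        ((Pi.single i 1 : Fin N → ℝ) b - (Pi.single i 1 : Fin N → ℝ) a)) /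
        ((y b - y a) ^ 2 + ε) * (β / 4) =
      (y i - y a) / ((y i - y a) ^ 2 + ε) * (β / 2) -
        (Pi.single i 1 : Fin N → ℝ) a *
          ∑ b, (y b - y a) / ((y b - y a) ^ 2 + ε) * (β / 2) := by
    intro a
    rw [Finset.sum_subset (Finset.subset_univ ({a}ᶜ : Finset (Fin N)))
      (fun b _ hb => by
        obtain rfl : b = a := by simpa using hb
        simp), Finset.mul_sum]
    have hi : (y i - y a) / ((y i - y a) ^ 2 + ε) * (β / 2) = ∑ b,
        (Pi.single i 1 : Fin N → ℝ) b * ((y b - y a) / ((y b - y a) ^ 2 + ε) * (β / 2)) := by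
      simp [Pi.single_apply]
    rw [hi, ← Finset.sum_sub_distrib]
    refine Finset.sum_congr rfl fun b _ => ?_
    push_cast
    ring
  rw [Finset.sum_congr rfl fun a _ => hsplit a, Finset.sum_sub_distrib]
  simp only [Pi.single_apply, ite_mul, one_mul, zero_mul, Finset.sum_ite_eq', Finset.mem_univ,
    if_true]
  rw [← Finset.sum_sub_distrib, Finset.mul_sum]
  refine Finset.sum_congr rfl fun j _ => ?_
  rw [← neg_sub (y i) (y j), neg_sq, neg_div]
  ring

lemma prod_comp_perm_eq {N : ℕ} (T : Finset (Fin N)) (σ : Equiv.Perm (Fin N))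
    (hσ : ∀ k, k ∈ T ↔ σ k ∈ T) (x : Fin N → ℝ) : ∏ k ∈ T, x (σ k) = ∏ k ∈ T, x k :=
  Finset.prod_equiv σ hσ (by simp)

lemma abs_prod_le {N : ℕ} (T : Finset (Fin N)) {x : Fin N → ℝ} (hx : ∀ k, 0 < x k) :
    |∏ k ∈ T, x k| ≤ (∏ k, (1 + x k)) ^ T.card := by
  rw [abs_of_nonneg (Finset.prod_nonneg fun k _ => (hx k).le), ← Finset.prod_const]
  exact Finset.prod_le_prod (fun k _ => (hx k).le)
    fun k _ => by linarith [one_add_le_prod_one_add hx k]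

/-- The unnormalized average of the monomial `∏_{k ∈ S} x_k` for the regularized ensemble. -/
noncomputable def regMoment {N : ℕ} (β γ ε : ℝ) (S : Finset (Fin N)) : ℝ :=
  ∫ x, (∏ k ∈ S, x k) * vandermondeReg β ε x * laguerreWeight γ x ∂orthantMeasure N

lemma integrable_regMoment {N : ℕ} {β γ ε : ℝ} (hβ : 0 < β) (hγ : -1 < γ) (h0 : 0 ≤ ε)
    (h1 : ε ≤ 1) (S : Finset (Fin N)) :
    Integrable (fun x => (∏ k ∈ S, x k) * vandermondeReg β ε x * laguerreWeight γ x)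
      (orthantMeasure N) := by
  obtain ⟨M, hM⟩ := exists_vandermondeReg_le N hβ
  refine integrable_mul_laguerreWeight hγ
    ((Finset.measurable_fun_prod _ fun k _ => measurable_pi_apply k).mul
      (measurable_vandermondeReg β ε)) 1 (S.card + M) fun x hx => ?_
  rw [abs_mul, abs_of_nonneg (vandermondeReg_nonneg β h0 x), one_mul, pow_add]
  exact mul_le_mul (abs_prod_le S hx) (hM ε h0 h1 x hx) (vandermondeReg_nonneg β h0 x)
    (pow_nonneg (zero_le_one.trans (one_le_prod_one_add hx)) _)

lemma integrable_interaction {N : ℕ} {β γ ε : ℝ} (hβ : 0 < β) (hγ : -1 < γ) (h0 : 0 < ε)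
    (h1 : ε ≤ 1) (T : Finset (Fin N)) (i j : Fin N) :
    Integrable (fun x => (∏ k ∈ T, x k) * ((x i - x j) / ((x i - x j) ^ 2 + ε)) *
      vandermondeReg β ε x * laguerreWeight γ x) (orthantMeasure N) := by
  obtain ⟨M, hM⟩ := exists_vandermondeReg_le N hβ
  refine integrable_mul_laguerreWeight hγ
    (((Finset.measurable_fun_prod _ fun k _ => measurable_pi_apply k).mul (by fun_prop)).mul
      (measurable_vandermondeReg β ε)) ε⁻¹ (T.card + 1 + M) fun x hx => ?_
  have hP := one_le_prod_one_add hx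
  rw [abs_mul, abs_mul, abs_of_nonneg (vandermondeReg_nonneg β h0.le x)]
  have hq : |(x i - x j) / ((x i - x j) ^ 2 + ε)| ≤ ε⁻¹ * ∏ k, (1 + x k) := by
    rw [abs_div, abs_of_pos (by positivity : 0 < (x i - x j) ^ 2 + ε), div_eq_inv_mul]
    refine mul_le_mul ?_ (abs_sub_le_prod_one_add hx i j) (abs_nonneg _) (by positivity)
    exact inv_anti₀ h0 (by nlinarith [sq_nonneg (x i - x j)])
  calc _ ≤ (∏ k, (1 + x k)) ^ T.card * (ε⁻¹ * ∏ k, (1 + x k)) * (∏ k, (1 + x k)) ^ M := by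
        have := abs_prod_le T hx
        have := hM ε h0.le h1 x hx
        have := vandermondeReg_nonneg β h0.le x
        gcongr
    _ = _ := by ring

lemma laguerreWeight_update {N : ℕ} (γ : ℝ) (i : Fin N) (x : Fin N → ℝ) (s : ℝ) :
    laguerreWeight γ (Function.update x i s) =
      s ^ γ * Real.exp (-s) * ∏ k ∈ Finset.univ.erase i, x k ^ γ * Real.exp (-(x k)) := by
  rw [laguerreWeight, ← Finset.mul_prod_erase _ _ (Finset.mem_univ i), Function.update_self]
  congr 1
  refine Finset.prod_congr rfl fun k hk => ?_
  rw [Function.update_of_ne (Finset.ne_of_mem_erase hk)]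

lemma prod_update_of_notMem {N : ℕ} {S : Finset (Fin N)} {i : Fin N} (hi : i ∉ S)
    (x : Fin N → ℝ) (s : ℝ) : ∏ k ∈ S, Function.update x i s k = ∏ k ∈ S, x k :=
  Finset.prod_congr rfl fun _ hk => Function.update_of_ne (ne_of_mem_of_not_mem hk hi) _ _

/-- Integration by parts in the variable `x_i` for the regularized ensemble. -/
lemma regMoment_insert {N : ℕ} {β γ ε : ℝ} (hβ : 0 < β) (hγ : -1 < γ) (h0 : 0 < ε)
    (h1 : ε ≤ 1) {S : Finset (Fin N)} {i : Fin N} (hi : i ∉ S) :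
    regMoment β γ ε (insert i S) = (γ + 1) * regMoment β γ ε S + β * ∑ j,
      ∫ x, (∏ k ∈ insert i S, x k) * ((x i - x j) / ((x i - x j) ^ 2 + ε)) *
        vandermondeReg β ε x * laguerreWeight γ x ∂orthantMeasure N := by
  have hA := (integrable_regMoment hβ hγ h0.le h1 S).const_mul (γ + 1)
  have hB := integrable_regMoment hβ hγ h0.le h1 (insert i S)
  have hJ := fun j => integrable_interaction hβ hγ h0 h1 (insert i S) i j
  have hC := (integrable_finsetSum Finset.univ fun j _ => hJ j).const_mul β
  have key := integral_orthantMeasure_eq_zero_of_hasDerivAt i hB ((hA.sub hB).add hC) ?_ ?_ ?_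
  · rw [integral_add' (hA.sub hB) hC, integral_sub' hA hB, integral_const_mul, integral_const_mul,
      integral_finsetSum _ fun j _ => hJ j] at key
    rw [regMoment, regMoment]
    linarith
  · intro x hx
    simp only [Pi.add_apply, Pi.sub_apply, Finset.prod_insert hi, prod_update_of_notMem hi,
      laguerreWeight_update, Function.update_self]
    have hv := hasDerivAt_vandermondeReg β h0 i x (x i)
    rw [Function.update_eq_self] at hv
    have hp := Real.hasDerivAt_rpow_const (p := γ) (Or.inl (hx i).ne')
    have he := (hasDerivAt_neg (x i)).exp
    have := (((hasDerivAt_id (x i)).mul_const (∏ k ∈ S, x k)).mul hv).mul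
      ((hp.mul he).mul_const (∏ k ∈ Finset.univ.erase i, x k ^ γ * Real.exp (-(x k))))
    refine this.congr_deriv ?_
    have hL := laguerreWeight_update γ i x (x i)
    rw [Function.update_eq_self] at hL
    simp only [Pi.mul_apply, Function.update_eq_self, id, hL,
      Real.rpow_sub_one (hx i).ne']
    simp only [← Finset.mul_sum, ← Finset.sum_mul]
    have := (hx i).ne'
    field_simp
    ring
  · intro x hx
    simp only [Finset.prod_insert hi, prod_update_of_notMem hi, laguerreWeight_update,
      Function.update_self]
    have hv : ContinuousWithinAt (fun s => vandermondeReg β ε (Function.update x i s)) (Ici 0) 0 :=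
      (hasDerivAt_vandermondeReg β h0 i x 0).continuousAt.continuousWithinAt
    have hr : ContinuousWithinAt (fun s : ℝ => s ^ (γ + 1)) (Ici 0) 0 :=
      (Real.continuousAt_rpow_const 0 (γ + 1) (Or.inr (by linarith))).continuousWithinAt
    have hm := ((hr.mul (Real.continuous_exp.comp continuous_neg).continuousWithinAt).mul hv).mul
      (continuousWithinAt_const
        (b := (∏ k ∈ S, x k) * ∏ k ∈ Finset.univ.erase i, x k ^ γ * Real.exp (-(x k))))
    refine hm.congr (fun s hs => ?_) ?_
    · simp only [Pi.mul_apply, Function.comp, Real.rpow_add_one' hs (by linarith : γ + 1 ≠ 0)]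
      ring
    · simp only [Pi.mul_apply, Function.comp,
        Real.rpow_add_one' (le_refl (0 : ℝ)) (by linarith : γ + 1 ≠ 0)]
      ring
  · intro x hx
    simp [Finset.prod_insert hi, hx]

lemma interaction_eq_zero {N : ℕ} (β γ ε : ℝ) {T : Finset (Fin N)} {i j : Fin N} (hi : i ∈ T)
    (hj : j ∈ T) :
    ∫ x, (∏ k ∈ T, x k) * ((x i - x j) / ((x i - x j) ^ 2 + ε)) *
        vandermondeReg β ε x * laguerreWeight γ x ∂orthantMeasure N = 0 := by
  have hT : ∀ k, k ∈ T ↔ Equiv.swap i j k ∈ T := by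
    intro k
    rw [Equiv.swap_apply_def]
    split_ifs <;> simp_all
  have h := integral_comp_swap_orthantMeasure i j fun x =>
    (∏ k ∈ T, x k) * ((x i - x j) / ((x i - x j) ^ 2 + ε)) *
        vandermondeReg β ε x * laguerreWeight γ x
  simp only [vandermondeReg_comp, laguerreWeight_comp, Function.comp_apply,
    prod_comp_perm_eq T _ hT, Equiv.swap_apply_left, Equiv.swap_apply_right] at h
  rw [← self_eq_neg, ← integral_neg, ← h]
  congr 1
  ext x
  rw [← neg_sub (x i) (x j), neg_sq, neg_div]
  ring

lemma interaction_eq_half {N : ℕ} {β γ ε : ℝ} (hβ : 0 < β) (hγ : -1 < γ) (h0 : 0 < ε)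
    (h1 : ε ≤ 1) {S : Finset (Fin N)} {i j : Fin N} (hi : i ∉ S) (hj : j ∉ S) :
    ∫ x, (∏ k ∈ insert i S, x k) * ((x i - x j) / ((x i - x j) ^ 2 + ε)) *
        vandermondeReg β ε x * laguerreWeight γ x ∂orthantMeasure N =
      1 / 2 * ∫ x, (∏ k ∈ S, x k) * ((x i - x j) ^ 2 / ((x i - x j) ^ 2 + ε)) *
        vandermondeReg β ε x * laguerreWeight γ x ∂orthantMeasure N := by
  have hS : ∀ k, k ∈ S ↔ Equiv.swap i j k ∈ S := by
    intro k
    rw [Equiv.swap_apply_def]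
    split_ifs <;> simp_all
  have h := integral_comp_swap_orthantMeasure i j fun x =>
    (∏ k ∈ insert i S, x k) * ((x i - x j) / ((x i - x j) ^ 2 + ε)) *
        vandermondeReg β ε x * laguerreWeight γ x
  have hI := integrable_interaction hβ hγ h0 h1 (insert i S) i j
  have hI' := integrable_interaction hβ hγ h0 h1 (insert j S) i j
  simp only [Finset.prod_insert hi, Finset.prod_insert hj, vandermondeReg_comp,
    laguerreWeight_comp, Function.comp_apply, prod_comp_perm_eq S _ hS,
    Equiv.swap_apply_left, Equiv.swap_apply_right] at h hI hI' ⊢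
  have h2 : ∫ x, (∏ k ∈ S, x k) * ((x i - x j) ^ 2 / ((x i - x j) ^ 2 + ε)) *
        vandermondeReg β ε x * laguerreWeight γ x ∂orthantMeasure N =
      (∫ x, x i * (∏ k ∈ S, x k) * ((x i - x j) / ((x i - x j) ^ 2 + ε)) *
        vandermondeReg β ε x * laguerreWeight γ x ∂orthantMeasure N) -
      ∫ x, x j * (∏ k ∈ S, x k) * ((x i - x j) / ((x i - x j) ^ 2 + ε)) *
        vandermondeReg β ε x * laguerreWeight γ x ∂orthantMeasure N := by
    rw [← integral_sub hI hI']
    congr 1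
    ext x
    ring
  have h3 : ∫ x, x j * (∏ k ∈ S, x k) * ((x j - x i) / ((x j - x i) ^ 2 + ε)) *
        vandermondeReg β ε x * laguerreWeight γ x ∂orthantMeasure N =
      -∫ x, x j * (∏ k ∈ S, x k) * ((x i - x j) / ((x i - x j) ^ 2 + ε)) *
        vandermondeReg β ε x * laguerreWeight γ x ∂orthantMeasure N := by
    rw [← integral_neg]
    congr 1
    ext x
    rw [← neg_sub (x i) (x j), neg_sq, neg_div]
    ring
  linarith

lemma continuous_vandermondeReg_eps {N : ℕ} {β : ℝ} (hβ : 0 < β) (x : Fin N → ℝ) :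
    Continuous fun ε => vandermondeReg β ε x := by
  unfold vandermondeReg
  exact continuous_finsetProd _ fun a _ => continuous_finsetProd _ fun b _ =>
    (continuous_const.add continuous_id).rpow_const fun _ => Or.inr (by positivity)

lemma tendsto_regMoment {N : ℕ} {β γ : ℝ} (hβ : 0 < β) (hγ : -1 < γ) (S : Finset (Fin N))
    (r : ℝ → (Fin N → ℝ) → ℝ) (hr : ∀ ε, Measurable (r ε))
    (hr1 : ∀ ε, 0 < ε → ∀ x, |r ε x| ≤ 1)
    (hlim : ∀ x, Tendsto (fun ε => r ε x * vandermondeReg β ε x) (𝓝[>] 0)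
      (𝓝 (vandermondeReg β 0 x))) :
    Tendsto (fun ε => ∫ x, (∏ k ∈ S, x k) * r ε x * vandermondeReg β ε x *
      laguerreWeight γ x ∂orthantMeasure N) (𝓝[>] 0) (𝓝 (regMoment β γ 0 S)) := by
  obtain ⟨M, hM⟩ := exists_vandermondeReg_le N hβ
  refine tendsto_integral_filter_of_dominated_convergence
    (fun x => (∏ k, (1 + x k)) ^ (S.card + M) * laguerreWeight γ x)
    (Eventually.of_forall fun ε => ?_) ?_
    (integrable_prod_one_add_pow_mul_laguerreWeight N _ hγ) (Eventually.of_forall fun x => ?_)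
  · exact ((((Finset.measurable_fun_prod _ fun k _ => measurable_pi_apply k).mul (hr ε)).mul
      (measurable_vandermondeReg β ε)).mul (measurable_laguerreWeight γ)).aestronglyMeasurable
  · filter_upwards [Ioo_mem_nhdsGT (zero_lt_one (α := ℝ))] with ε hε
    filter_upwards [ae_pos_orthantMeasure N] with x hx
    have hP := zero_le_one.trans (one_le_prod_one_add hx)
    rw [Real.norm_eq_abs, abs_mul, abs_mul, abs_mul, abs_of_nonneg (laguerreWeight_nonneg γ hx),
      abs_of_nonneg (vandermondeReg_nonneg β hε.1.le x), pow_add]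
    refine mul_le_mul_of_nonneg_right ?_ (laguerreWeight_nonneg γ hx)
    refine mul_le_mul ?_ (hM ε hε.1.le hε.2.le x hx) (vandermondeReg_nonneg β hε.1.le x)
      (pow_nonneg hP _)
    exact (mul_le_of_le_one_right (abs_nonneg _) (hr1 ε hε.1 x)).trans (abs_prod_le S hx)
  · simp only [mul_assoc (∏ k ∈ S, x k)]
    exact ((hlim x).mul_const _).const_mul _

lemma tendsto_interaction {N : ℕ} {β γ : ℝ} (hβ : 0 < β) (hγ : -1 < γ) (S : Finset (Fin N))
    {i j : Fin N} (hij : i ≠ j) :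
    Tendsto (fun ε => ∫ x, (∏ k ∈ S, x k) * ((x i - x j) ^ 2 / ((x i - x j) ^ 2 + ε)) *
      vandermondeReg β ε x * laguerreWeight γ x ∂orthantMeasure N) (𝓝[>] 0)
      (𝓝 (regMoment β γ 0 S)) := by
  refine tendsto_regMoment hβ hγ S (fun ε x => (x i - x j) ^ 2 / ((x i - x j) ^ 2 + ε))
    (fun ε => by fun_prop) (fun ε hε x => ?_) fun x => ?_
  · rw [abs_of_nonneg (by positivity)]
    exact div_le_one_of_le₀ (by linarith) (by positivity)
  · have hv := (continuous_vandermondeReg_eps hβ x).tendsto 0 |>.mono_left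
      (nhdsWithin_le_nhds (s := Ioi 0))
    by_cases h : x i = x j
    · have : vandermondeReg β 0 x = 0 := by
        refine Finset.prod_eq_zero (Finset.mem_univ i)
          (Finset.prod_eq_zero (i := j) (by simpa using hij.symm) ?_)
        rw [h, sub_self, zero_pow two_ne_zero, add_zero, Real.zero_rpow (by positivity)]
      rw [this]
      simp [h]
    · have hne : (x i - x j) ^ 2 + 0 ≠ 0 := by simpa [sub_eq_zero] using h
      have hc : Tendsto (fun ε : ℝ => (x i - x j) ^ 2 / ((x i - x j) ^ 2 + ε)) (𝓝[>] 0)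
          (𝓝 ((x i - x j) ^ 2 / ((x i - x j) ^ 2 + 0))) :=
        (tendsto_const_nhds.div (tendsto_const_nhds.add tendsto_id) hne).mono_left
          nhdsWithin_le_nhds
      have := hc.mul hv
      rwa [add_zero, div_self (by simpa using hne), one_mul] at this

/-- Aomoto's recurrence for the averages of monomials. -/
lemma regMoment_zero_insert {N : ℕ} {β γ : ℝ} (hβ : 0 < β) (hγ : -1 < γ)
    {S : Finset (Fin N)} {i : Fin N} (hi : i ∉ S) :
    regMoment β γ 0 (insert i S) =
      (γ + 1 + β / 2 * (N - 1 - S.card)) * regMoment β γ 0 S := by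
  have hmom : ∀ T : Finset (Fin N),
      Tendsto (fun ε => regMoment β γ ε T) (𝓝[>] 0) (𝓝 (regMoment β γ 0 T)) := by
    intro T
    simpa only [mul_one, regMoment] using tendsto_regMoment hβ hγ T (fun _ _ => 1)
      (fun _ => measurable_const) (fun _ _ _ => by simp) fun x => by
        simpa using (continuous_vandermondeReg_eps hβ x).tendsto 0 |>.mono_left
          (nhdsWithin_le_nhds (s := Ioi 0))
  have hInt : ∀ j, Tendsto (fun ε => ∫ x, (∏ k ∈ insert i S, x k) *
      ((x i - x j) / ((x i - x j) ^ 2 + ε)) * vandermondeReg β ε x * laguerreWeight γ x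
        ∂orthantMeasure N) (𝓝[>] 0)
      (𝓝 (if j ∈ insert i S then 0 else 1 / 2 * regMoment β γ 0 S)) := by
    intro j
    split_ifs with hj
    · simp only [interaction_eq_zero β γ _ (Finset.mem_insert_self i S) hj]
      exact tendsto_const_nhds
    · rw [Finset.mem_insert, not_or] at hj
      refine ((tendsto_interaction hβ hγ S (Ne.symm hj.1)).const_mul (1 / 2)).congr' ?_
      filter_upwards [Ioo_mem_nhdsGT (zero_lt_one (α := ℝ))] with ε hε
      rw [interaction_eq_half hβ hγ hε.1 hε.2.le hi hj.2]
  have hrhs := ((hmom S).const_mul (γ + 1)).add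
    ((tendsto_finsetSum Finset.univ fun j _ => hInt j).const_mul β)
  have heq := tendsto_nhds_unique ((hmom (insert i S)).congr' (by
    filter_upwards [Ioo_mem_nhdsGT (zero_lt_one (α := ℝ))] with ε hε
    exact regMoment_insert hβ hγ hε.1 hε.2.le hi)) hrhs
  have hcard : ((Finset.univ.filter fun j => j ∉ insert i S).card : ℝ) = N - 1 - S.card := by
    have h1 := Finset.card_add_card_compl (insert i S)
    rw [Finset.card_insert_of_notMem hi, Fintype.card_fin] at h1
    rw [← Finset.compl_filter, Finset.filter_mem_eq_inter, Finset.univ_inter]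
    have h2 : ((S.card + 1 + (insert i S)ᶜ.card : ℕ) : ℝ) = N := by rw [h1]
    push_cast at h2
    linarith
  rw [heq, Finset.sum_ite, Finset.sum_const_zero, Finset.sum_const, nsmul_eq_mul, hcard]
  ring

lemma regMoment_zero_eq_prod {N : ℕ} {β γ : ℝ} (hβ : 0 < β) (hγ : -1 < γ)
    (S : Finset (Fin N)) :
    regMoment β γ 0 S = (∏ m ∈ Finset.range S.card, (γ + 1 + β / 2 * (N - 1 - m))) *
      regMoment β γ 0 (∅ : Finset (Fin N)) := by
  induction S using Finset.induction_on with
  | empty => simp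
  | insert i S hi ih =>
    rw [regMoment_zero_insert hβ hγ hi, ih, Finset.card_insert_of_notMem hi,
      Finset.prod_range_succ]
    ring

lemma regMoment_empty_add_natCast {β γ : ℝ} (N n : ℕ) :
    regMoment β (γ + n) 0 (∅ : Finset (Fin N)) =
      ∫ x : Fin N → ℝ, (∏ k, x k ^ n) * (vandermondeReg β 0 x * laguerreWeight γ x)
        ∂orthantMeasure N := by
  refine integral_congr_ae ?_
  filter_upwards [ae_pos_orthantMeasure N] with x hx
  rw [laguerreWeight_add_natCast γ n hx, Finset.prod_empty]
  ring

lemma regMoment_empty_add_one {β γ : ℝ} (hβ : 0 < β) (hγ : -1 < γ) (N : ℕ) :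
    regMoment β (γ + 1) 0 (∅ : Finset (Fin N)) =
      (∏ m ∈ Finset.range N, (γ + 1 + β / 2 * m)) *
        regMoment β γ 0 (∅ : Finset (Fin N)) := by
  have h := regMoment_empty_add_natCast (β := β) (γ := γ) N 1
  have h2 := regMoment_zero_eq_prod hβ hγ (Finset.univ : Finset (Fin N))
  rw [← Finset.prod_range_reflect, Finset.card_univ, Fintype.card_fin] at h2
  rw [Nat.cast_one] at h
  simp only [pow_one, ← mul_assoc] at h
  rw [h, ← regMoment, h2]
  congr 1
  refine Finset.prod_congr rfl fun m hm => ?_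
  have hm := Finset.mem_range.1 hm
  rw [Nat.sub_sub, Nat.cast_sub (by omega)]
  push_cast
  ring

lemma regMoment_empty_shift {β γ : ℝ} (hβ : 0 < β) (hγ : -1 < γ) (N n : ℕ) :
    regMoment β (γ + n) 0 (∅ : Finset (Fin N)) =
      (∏ k ∈ Finset.range n, ∏ m ∈ Finset.range N, (γ + k + 1 + β / 2 * m)) *
        regMoment β γ 0 (∅ : Finset (Fin N)) := by
  induction n with
  | zero => simp
  | succ n ih =>
    have hn : -1 < γ + n := by linarith [n.cast_nonneg (α := ℝ)]
    rw [Nat.cast_succ, ← add_assoc, regMoment_empty_add_one hβ hn, ih, Finset.prod_range_succ]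
    ring

lemma regMoment_empty_pos {β γ : ℝ} (hβ : 0 < β) (hγ : -1 < γ) (N : ℕ) :
    0 < regMoment β γ 0 (∅ : Finset (Fin N)) := by
  have hInt := integrable_regMoment hβ hγ le_rfl zero_le_one (∅ : Finset (Fin N))
  have hnn : 0 ≤ᵐ[orthantMeasure N] fun x => (∏ k ∈ (∅ : Finset (Fin N)), x k) *
      vandermondeReg β 0 x * laguerreWeight γ x := by
    filter_upwards [ae_pos_orthantMeasure N] with x hx
    rw [Finset.prod_empty, one_mul]
    exact mul_nonneg (vandermondeReg_nonneg β le_rfl x) (laguerreWeight_nonneg γ hx)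
  rw [regMoment, integral_pos_iff_support_of_nonneg_ae hnn hInt]
  let U : Set (Fin N → ℝ) := {x | (∀ i, 0 < x i) ∧ ∀ a b, b ≠ a → x b ≠ x a}
  have hU : IsOpen U := by
    simp only [U, Set.ofPred_and, Set.ofPred_forall]
    exact (isOpen_iInter_of_finite fun i =>
      isOpen_lt continuous_const (continuous_apply i)).inter
      (isOpen_iInter_of_finite fun a => isOpen_iInter_of_finite fun b =>
        isOpen_iInter_of_finite fun _ => isOpen_ne_fun (continuous_apply b) (continuous_apply a))
  have hne : U.Nonempty := by
    refine ⟨fun i => (i : ℝ) + 1, fun i => by positivity, fun a b hab h => hab ?_⟩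
    simpa [Fin.ext_iff] using h
  have hpos : 0 < orthantMeasure N U := by
    rw [orthantMeasure_eq_restrict, Measure.restrict_apply hU.measurableSet,
      inter_eq_left.2 fun x hx => hx.1]
    exact hU.measure_pos _ hne
  refine hpos.trans_le (measure_mono fun x hx => ?_)
  rw [Function.mem_support, Finset.prod_empty, one_mul]
  refine mul_ne_zero (Finset.prod_ne_zero_iff.2 fun a _ => Finset.prod_ne_zero_iff.2 fun b hb => ?_)
    (Finset.prod_ne_zero_iff.2 fun k _ => ?_)
  · have : x b - x a ≠ 0 := sub_ne_zero.2 (hx.2 a b (by simpa using hb))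
    have : 0 < (x b - x a) ^ 2 + 0 := by positivity
    exact (Real.rpow_pos_of_pos this _).ne'
  · exact (mul_pos (Real.rpow_pos_of_pos (hx.1 k) _) (Real.exp_pos _)).ne'

lemma chAvg_prod_pow {β γ : ℝ} (hβ : 0 < β) (hγ : -1 < γ) (N n : ℕ) :
    chAvg N β γ (fun x => ∏ i, x i ^ n) =
      ∏ k ∈ Finset.range n, ∏ m ∈ Finset.range N, (γ + k + 1 + β / 2 * m) := by
  have h0 := regMoment_empty_add_natCast (β := β) (γ := γ) N 0
  simp only [Nat.cast_zero, add_zero, pow_zero, Finset.prod_const_one, one_mul] at h0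
  have h : chAvg N β γ (fun x => ∏ i, x i ^ n) =
      regMoment β (γ + n) 0 (∅ : Finset (Fin N)) / regMoment β γ 0 (∅ : Finset (Fin N)) := by
    rw [regMoment_empty_add_natCast, h0, orthantMeasure_eq_restrict]
    simp only [chAvg, vandermondeReg_zero, laguerreWeight]
  rw [h, regMoment_empty_shift hβ hγ, mul_div_cancel_right₀ _ (regMoment_empty_pos hβ hγ N).ne']

/-- Duality for moments of the determinant in the chiral β-Ensembles:
for `β > 0`, `β' = 4/β`, `γ > −1` and `γ' = 2(γ+1)/β − 1 > −1`,
`⟨(x₁⋯x_N)^n⟩_{chβE^γ_N} = (β/2)^{nN} ⟨(x₁⋯x_n)^N⟩_{chβ'E^{γ'}_n}`. -/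
theorem chiral_determinant_moment_duality (β γ : ℝ) (hβ : 0 < β)
    (hγ : -1 < γ) (hγ' : -1 < 2 * (γ + 1) / β - 1) (N n : ℕ) :
    chAvg N β γ (fun x => ∏ i, x i ^ n)
      = (β / 2) ^ (n * N) *
          chAvg n (4 / β) (2 * (γ + 1) / β - 1) (fun x => ∏ i, x i ^ N) := by
  rw [chAvg_prod_pow hβ hγ, chAvg_prod_pow (by positivity) hγ', Finset.prod_comm, pow_mul,
    ← Finset.card_range N, ← Finset.prod_const, Finset.card_range, ← Finset.prod_mul_distrib]
  refine Finset.prod_congr rfl fun m _ => ?_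
  conv_rhs => rw [← Finset.card_range n, ← Finset.prod_const, Finset.card_range,
    ← Finset.prod_mul_distrib]
  refine Finset.prod_congr rfl fun k _ => ?_
  field_simp
  ring
end
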